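/- Let X = {a} ∪ ℝ, where a ∉ ℝ, with the topology τ generated by the base {{a}} ∪ {{a, r} : r ∈ ℝ}. Then the set ℝ (i.e., X ∖ {a}) is not θ_ω-open in X; indeed, for every real r and every open neighborhood V of r, the ω-closure of V contains a, so Cl_ω(V) ∖ ℝ ≠ ∅. -/

import Mathlib

open Set TopologicalSpace

/-- `A` is ω-open if every point of `A` has an open neighborhood `U`
with `U \ A` countable. -/
def IsOmegaOpen (X : Type*) [TopologicalSpace X] (A : Set X) : Prop :=
  ∀ x ∈ A, ∃ U : Set X, IsOpen U ∧ x ∈ U ∧ (U \ A).Countable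

/-- The ω-closure: closure with respect to the topology of ω-open sets. -/
def ClOmega (X : Type*) [TopologicalSpace X] (A : Set X) : Set X :=
  {x | ∀ V : Set X, IsOmegaOpen X V → x ∈ V → (V ∩ A).Nonempty}

/-- The θω-closure: `Cl_{θω}(A) = {x : Cl_ω(U) ∩ A ≠ ∅ for every open nbhd U of x}`. -/
def ClThetaOmega (X : Type*) [TopologicalSpace X] (A : Set X) : Set X :=
  {x | ∀ U : Set X, IsOpen U → x ∈ U → (ClOmega X U ∩ A).Nonempty}

/-- `A` is θω-open iff its complement is θω-closed. -/
def IsThetaOmegaOpen (X : Type*) [TopologicalSpace X] (A : Set X) : Prop :=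
  ClThetaOmega X Aᶜ = Aᶜ

/-- The space `X = {a} ∪ ℝ` (with `a ∉ ℝ`) modelled as `Option ℝ`, where `a = none`
and each real `r` is `some r`, with the topology generated by the base
`{{a}} ∪ {{a, r} : r ∈ ℝ}`. -/
def tauX : TopologicalSpace (Option ℝ) :=
  TopologicalSpace.generateFrom
    (insert {none} {s : Set (Option ℝ) | ∃ r : ℝ, s = {none, some r}})

/-- Every nonempty open set of the space `X` contains the point `a`. -/
theorem none_mem_of_isOpen_tauX {V : Set (Option ℝ)} (hV : @IsOpen (Option ℝ) tauX V)
    (hne : V.Nonempty) :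
    none ∈ V := by
  have hgen : GenerateOpen
      (insert {none} {s : Set (Option ℝ) | ∃ r : ℝ, s = {none, some r}}) V := hV
  clear hV
  induction hgen with
  | basic s hs =>
    rcases hs with rfl | ⟨r, rfl⟩ <;> simp
  | univ => trivial
  | inter s t _ _ ihs iht => exact ⟨ihs hne.left, iht hne.right⟩
  | sUnion S _ ih =>
    obtain ⟨x, s, hs, hx⟩ := hne
    exact ⟨s, hs, ih s hs ⟨x, hx⟩⟩

/-- A set is contained in its ω-closure. -/
theorem subset_clOmega (X : Type*) [TopologicalSpace X] (A : Set X) : A ⊆ ClOmega X A :=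
  fun x hx _ _ hxV => ⟨x, hxV, hx⟩

/-- In the space `X = {a} ∪ ℝ` with the base `{{a}} ∪ {{a,r} : r ∈ ℝ}`,
the set `ℝ = X \ {a}` is not θω-open; indeed for every real `r` and every open
neighborhood `V` of `r`, the ω-closure of `V` contains `a`,
so `Cl_ω(V) \ ℝ ≠ ∅`. -/
theorem reals_not_thetaOmegaOpen :
    ¬ @IsThetaOmegaOpen (Option ℝ) tauX ({none}ᶜ) ∧
      ∀ (r : ℝ) (V : Set (Option ℝ)), @IsOpen (Option ℝ) tauX V → some r ∈ V →
        none ∈ @ClOmega (Option ℝ) tauX V ∧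
          (@ClOmega (Option ℝ) tauX V \ ({none}ᶜ : Set (Option ℝ))).Nonempty := by
  have key : ∀ (r : ℝ) (V : Set (Option ℝ)), @IsOpen (Option ℝ) tauX V → some r ∈ V →
      none ∈ @ClOmega (Option ℝ) tauX V := fun r V hV hr =>
    @subset_clOmega _ tauX V _ (none_mem_of_isOpen_tauX hV ⟨some r, hr⟩)
  refine ⟨fun h => ?_, fun r V hV hr => ⟨key r V hV hr, none, key r V hV hr, by simp⟩⟩
  have hmem : some (0 : ℝ) ∈ @ClThetaOmega (Option ℝ) tauX ({none}ᶜ)ᶜ :=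
    fun U hU h0 => ⟨none, key 0 U hU h0, by simp⟩
  have hcompl : some (0 : ℝ) ∈ (({none}ᶜ)ᶜ : Set (Option ℝ)) := h ▸ hmem
  simp at hcompl
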